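/- Let n ≥ 3. For the flower graph F_n, the maximum first chromatic Zagreb index satisfies M₁^{φ+}(F_n) = 13n + 1 if n is even, and M₁^{φ+}(F_n) = 25n − 4 if n is odd. -/

import Mathlib

open Finset

/-- Vertex type: `none` is the center `u`; `some (Sum.inl i)` is `uᵢ`;
`some (Sum.inr i)` is `vᵢ`. -/
abbrev GV (n : ℕ) : Type := Option (Fin n ⊕ Fin n)

/-- `j = i + 1 (mod n)`: `j` is the cyclic successor of `i` in `Fin n`. -/
def NextIdx {n : ℕ} (i j : Fin n) : Prop := (j : ℕ) = ((i : ℕ) + 1) % n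

/-- The flower graph `F_n`: edges `uᵢu_{i+1}` (indices mod `n`), `u uᵢ`,
`uᵢvᵢ` and `u vᵢ` for all `i`. -/
def flowerGraph (n : ℕ) : SimpleGraph (GV n) :=
  SimpleGraph.fromRel (fun a b =>
    (∃ i j : Fin n, NextIdx i j ∧ a = some (Sum.inl i) ∧ b = some (Sum.inl j)) ∨
    (∃ i : Fin n, a = none ∧ b = some (Sum.inl i)) ∨
    (∃ i : Fin n, a = some (Sum.inl i) ∧ b = some (Sum.inr i)) ∨
    (∃ i : Fin n, a = none ∧ b = some (Sum.inr i)))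

/-- `ζ` is a proper vertex coloring of `G` using the colors `{1, …, k}`:
every vertex gets a color in `{1, …, k}` and adjacent vertices get
different colors. -/
def IsProperColoring {V : Type} (G : SimpleGraph V) (k : ℕ) (ζ : V → ℕ) : Prop :=
  (∀ v, 1 ≤ ζ v ∧ ζ v ≤ k) ∧ ∀ ⦃a b⦄, G.Adj a b → ζ a ≠ ζ b

/-- The chromatic number of `G`, as a natural number. -/
noncomputable def chi {V : Type} (G : SimpleGraph V) : ℕ := G.chromaticNumber.toNat

/-- The first chromatic Zagreb index: `∑_{v ∈ V(G)} ζ(v)²`. -/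
def M1 {V : Type} [Fintype V] (ζ : V → ℕ) : ℚ := ∑ v, (ζ v : ℚ) ^ 2

theorem isProperColoring_flowerGraph_iff {n : ℕ} (hn : 2 ≤ n) (k : ℕ) (ζ : GV n → ℕ) :
    IsProperColoring (flowerGraph n) k ζ ↔
      (∀ v, 1 ≤ ζ v ∧ ζ v ≤ k) ∧
      (∀ i j, NextIdx i j → ζ (some (Sum.inl i)) ≠ ζ (some (Sum.inl j))) ∧
      ∀ i, ζ none ≠ ζ (some (Sum.inl i)) ∧ ζ none ≠ ζ (some (Sum.inr i)) ∧
        ζ (some (Sum.inl i)) ≠ ζ (some (Sum.inr i)) := by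
  refine and_congr_right fun _ => ⟨fun h => ⟨fun i j hij => h ?_, fun i => ⟨h ?_, h ?_, h ?_⟩⟩, ?_⟩
  · have hne : i ≠ j := by
      rintro rfl
      have hi := i.isLt
      unfold NextIdx at hij
      rcases Nat.lt_or_ge ((i : ℕ) + 1) n with h1 | h1
      · rw [Nat.mod_eq_of_lt h1] at hij
        omega
      · rw [show (i : ℕ) + 1 = n by omega, Nat.mod_self] at hij
        omega
    exact (SimpleGraph.fromRel_adj _ _ _).2 ⟨by simpa using hne, .inl (.inl ⟨i, j, hij, rfl, rfl⟩)⟩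
  · exact (SimpleGraph.fromRel_adj _ _ _).2 ⟨by simp, .inl (.inr (.inl ⟨i, rfl, rfl⟩))⟩
  · exact (SimpleGraph.fromRel_adj _ _ _).2 ⟨by simp, .inl (.inr (.inr (.inr ⟨i, rfl, rfl⟩)))⟩
  · exact (SimpleGraph.fromRel_adj _ _ _).2 ⟨by simp, .inl (.inr (.inr (.inl ⟨i, rfl, rfl⟩)))⟩
  · rintro ⟨hc, hs⟩ a b hab
    rcases ((SimpleGraph.fromRel_adj _ _ _).1 hab).2 with h | h <;>
    rcases h with ⟨i, j, hij, rfl, rfl⟩ | ⟨i, rfl, rfl⟩ | ⟨i, rfl, rfl⟩ | ⟨i, rfl, rfl⟩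
    exacts [hc i j hij, (hs i).1, (hs i).2.2, (hs i).2.1,
      (hc i j hij).symm, (hs i).1.symm, (hs i).2.2.symm, (hs i).2.1.symm]

theorem colorable_iff_exists_isProperColoring {V : Type} (G : SimpleGraph V) (k : ℕ) :
    G.Colorable k ↔ ∃ ζ : V → ℕ, IsProperColoring G k ζ := by
  constructor
  · rintro ⟨C⟩
    refine ⟨fun v => C v + 1, fun v => ⟨Nat.le_add_left 1 _, (C v).isLt⟩,
      fun a b hab h => C.valid hab ?_⟩
    exact Fin.ext (Nat.succ_injective h)
  · rintro ⟨ζ, hb, hζ⟩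
    refine ⟨SimpleGraph.Coloring.mk (fun v => ⟨ζ v - 1, by have := hb v; omega⟩) ?_⟩
    intro a b hab h
    have h' : ζ a - 1 = ζ b - 1 := congrArg Fin.val h
    have ha := hb a
    have hb := hb b
    exact hζ hab (by omega)

theorem chi_eq_succ {V : Type} {G : SimpleGraph V} {k : ℕ} {ζ : V → ℕ}
    (h : IsProperColoring G (k + 1) ζ) (h' : ∀ ξ : V → ℕ, ¬ IsProperColoring G k ξ) :
    chi G = k + 1 := by
  have hk : G.chromaticNumber = ((k + 1 : ℕ) : ℕ∞) := by
    refine SimpleGraph.chromaticNumber_eq_iff_colorable_not_colorable.2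
      ⟨(colorable_iff_exists_isProperColoring G _).2 ⟨ζ, h⟩, fun hc => ?_⟩
    obtain ⟨ξ, hξ⟩ := (colorable_iff_exists_isProperColoring G _).1 hc
    exact h' ξ hξ
  rw [chi, hk, ENat.toNat_natCast]

/-- An odd cycle has no alternating predicate. -/
theorem Odd.exists_nextIdx_iff {n : ℕ} (hn : Odd n) (p : Fin n → Prop) :
    ∃ i j, NextIdx i j ∧ (p i ↔ p j) := by
  by_contra! h
  have hpos : 0 < n := hn.pos
  have key : ∀ k (hk : k < n), (p ⟨k, hk⟩ ↔ (Even k ↔ p ⟨0, hpos⟩)) := by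
    intro k
    induction k with
    | zero => simp
    | succ k ih =>
      intro hk
      have h1 := ih (by omega)
      have h2 := h ⟨k, by omega⟩ ⟨k + 1, hk⟩ (Nat.mod_eq_of_lt hk).symm
      rw [Nat.even_add_one]
      tauto
  have h1 := key (n - 1) (by omega)
  have h2 := h ⟨n - 1, by omega⟩ ⟨0, hpos⟩ (by simp [NextIdx, Nat.sub_add_cancel hpos])
  have h3 : Even (n - 1) := hn.tsub_odd odd_one
  tauto

/-- A proper coloring of an odd cycle uses a color outside any given pair. -/
theorem Odd.exists_ne_ne_of_nextIdx {n : ℕ} (hn : Odd n) (f : Fin n → ℕ)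
    (hf : ∀ i j, NextIdx i j → f i ≠ f j) (a b : ℕ) : ∃ i, f i ≠ a ∧ f i ≠ b := by
  by_contra! h
  obtain ⟨i, j, hij, hp⟩ := hn.exists_nextIdx_iff fun i => f i = a
  have := hf i j hij
  have := h i
  have := h j
  grind

theorem M1_eq {n : ℕ} (ζ : GV n → ℕ) :
    M1 ζ = (ζ none : ℚ) ^ 2 +
      ∑ i, ((ζ (some (Sum.inl i)) : ℚ) ^ 2 + (ζ (some (Sum.inr i)) : ℚ) ^ 2) := by
  simp [M1, Fintype.sum_option, Fintype.sum_sum_type, Finset.sum_add_distrib]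

theorem sum_le_of_exists_le {n : ℕ} {w : Fin n → ℚ} {W m : ℚ} (hW : ∀ i, w i ≤ W)
    (hm : ∃ i, w i ≤ m) : ∑ i, w i ≤ W * n - (W - m) := by
  obtain ⟨i, hi⟩ := hm
  have h := Finset.sum_le_sum fun j (_ : j ∈ Finset.univ.erase i) => hW j
  have h1 := Finset.add_sum_erase Finset.univ w (Finset.mem_univ i)
  have h2 := Finset.add_sum_erase Finset.univ (fun _ : Fin n => W) (Finset.mem_univ i)
  simp only [Finset.sum_const, Finset.card_univ, Fintype.card_fin, nsmul_eq_mul] at h h1 h2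
  linarith

/-- Color the center `1` and the rim alternately `2`, `3`. -/
def evenFlowerColoring (n : ℕ) : GV n → ℕ
  | none => 1
  | some (Sum.inl i) => if (i : ℕ) % 2 = 0 then 2 else 3
  | some (Sum.inr i) => if (i : ℕ) % 2 = 0 then 3 else 2

theorem isProperColoring_evenFlowerColoring {n : ℕ} (hn : 2 ≤ n) (he : Even n) :
    IsProperColoring (flowerGraph n) 3 (evenFlowerColoring n) := by
  rw [isProperColoring_flowerGraph_iff hn]
  refine ⟨?_, fun i j hij => ?_, fun i => ?_⟩
  · rintro (_ | i | i) <;> simp only [evenFlowerColoring] <;> grind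
  · have hi := i.isLt
    unfold NextIdx at hij
    obtain ⟨m, rfl⟩ := he
    simp only [evenFlowerColoring]
    rcases Nat.lt_or_ge ((i : ℕ) + 1) (m + m) with h1 | h1
    · rw [Nat.mod_eq_of_lt h1] at hij
      grind
    · rw [show (i : ℕ) + 1 = m + m by omega, Nat.mod_self] at hij
      grind
  · simp only [evenFlowerColoring]
    grind

/-- Color the center `1`, the rim vertex `u₀` by `2`, and the rest of the rim
alternately `3`, `4`. -/
def oddFlowerColoring (n : ℕ) : GV n → ℕ
  | none => 1
  | some (Sum.inl i) => if (i : ℕ) = 0 then 2 else if (i : ℕ) % 2 = 0 then 4 else 3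
  | some (Sum.inr i) => if (i : ℕ) = 0 then 4 else if (i : ℕ) % 2 = 0 then 3 else 4

theorem isProperColoring_oddFlowerColoring {n : ℕ} (hn : 2 ≤ n) :
    IsProperColoring (flowerGraph n) 4 (oddFlowerColoring n) := by
  rw [isProperColoring_flowerGraph_iff hn]
  refine ⟨?_, fun i j hij => ?_, fun i => ?_⟩
  · rintro (_ | i | i) <;> simp only [oddFlowerColoring] <;> grind
  · have hi := i.isLt
    unfold NextIdx at hij
    simp only [oddFlowerColoring]
    rcases Nat.lt_or_ge ((i : ℕ) + 1) n with h1 | h1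
    · rw [Nat.mod_eq_of_lt h1] at hij
      grind
    · rw [show (i : ℕ) + 1 = n by omega, Nat.mod_self] at hij
      grind
  · simp only [oddFlowerColoring]
    grind

theorem chi_flowerGraph_of_even {n : ℕ} (hn : 2 ≤ n) (he : Even n) : chi (flowerGraph n) = 3 := by
  refine chi_eq_succ (isProperColoring_evenFlowerColoring hn he) fun ξ hξ => ?_
  obtain ⟨hb, -, hs⟩ := (isProperColoring_flowerGraph_iff hn _ _).1 hξ
  let i : Fin n := ⟨0, by omega⟩
  have h0 := hb none
  have h1 := hb (some (Sum.inl i))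
  have h2 := hb (some (Sum.inr i))
  have h3 := hs i
  omega

theorem chi_flowerGraph_of_odd {n : ℕ} (hn : 2 ≤ n) (ho : Odd n) : chi (flowerGraph n) = 4 := by
  refine chi_eq_succ (isProperColoring_oddFlowerColoring hn) fun ξ hξ => ?_
  obtain ⟨hb, hc, hs⟩ := (isProperColoring_flowerGraph_iff hn _ _).1 hξ
  have h0 := hb none
  obtain ⟨a, b, hab⟩ : ∃ a b, ∀ x, 1 ≤ x → x ≤ 3 → x = ξ none ∨ x = a ∨ x = b := by
    obtain h | h | h : ξ none = 1 ∨ ξ none = 2 ∨ ξ none = 3 := by omega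
    exacts [⟨2, 3, by omega⟩, ⟨1, 3, by omega⟩, ⟨1, 2, by omega⟩]
  obtain ⟨i, hi⟩ := ho.exists_ne_ne_of_nextIdx _ hc a b
  have h1 := hb (some (Sum.inl i))
  have h2 := hab _ h1.1 h1.2
  have h3 := (hs i).1
  omega

theorem M1_evenFlowerColoring (n : ℕ) : M1 (evenFlowerColoring n) = 13 * n + 1 := by
  have h : ∀ i : Fin n, ((evenFlowerColoring n (some (Sum.inl i)) : ℚ) ^ 2 +
      (evenFlowerColoring n (some (Sum.inr i)) : ℚ) ^ 2) = 13 := by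
    intro i
    simp only [evenFlowerColoring]
    split_ifs <;> norm_num
  rw [M1_eq, Finset.sum_congr rfl fun i _ => h i]
  simp [evenFlowerColoring]
  ring

theorem M1_oddFlowerColoring {n : ℕ} (hn : 0 < n) : M1 (oddFlowerColoring n) = 25 * n - 4 := by
  have h : ∀ i : Fin n, ((oddFlowerColoring n (some (Sum.inl i)) : ℚ) ^ 2 +
      (oddFlowerColoring n (some (Sum.inr i)) : ℚ) ^ 2) = 25 - if i = ⟨0, hn⟩ then 5 else 0 := by
    intro i
    simp only [oddFlowerColoring, Fin.ext_iff]
    split_ifs <;> norm_num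
  rw [M1_eq, Finset.sum_congr rfl fun i _ => h i, Finset.sum_sub_distrib]
  simp [oddFlowerColoring]
  ring

theorem M1_le_of_even {n : ℕ} (hn : 2 ≤ n) {ζ : GV n → ℕ}
    (hζ : IsProperColoring (flowerGraph n) 3 ζ) : M1 ζ ≤ 13 * n + 1 := by
  obtain ⟨hb, -, hs⟩ := (isProperColoring_flowerGraph_iff hn _ _).1 hζ
  have hn' : (2 : ℚ) ≤ n := by exact_mod_cast hn
  have h0 := hb none
  have key (W : ℚ) (hW : ∀ x y : ℕ, 1 ≤ x → x ≤ 3 → 1 ≤ y → y ≤ 3 → x ≠ y → ζ none ≠ x →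
      ζ none ≠ y → (x : ℚ) ^ 2 + (y : ℚ) ^ 2 ≤ W) : M1 ζ ≤ (ζ none : ℚ) ^ 2 + n * W := by
    rw [M1_eq]
    gcongr
    simpa using Finset.sum_le_card_nsmul Finset.univ _ W fun i _ =>
      hW _ _ (hb _).1 (hb _).2 (hb _).1 (hb _).2 (hs i).2.2 (hs i).1 (hs i).2.1
  obtain h | h | h : ζ none = 1 ∨ ζ none = 2 ∨ ζ none = 3 := by omega
  all_goals rw [h] at key
  · refine (key 13 ?_).trans (by push_cast; linarith)
    intro x y _ _ _ _ _ _ _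
    interval_cases x <;> interval_cases y <;> first | omega | norm_num
  · refine (key 10 ?_).trans (by push_cast; linarith)
    intro x y _ _ _ _ _ _ _
    interval_cases x <;> interval_cases y <;> first | omega | norm_num
  · refine (key 5 ?_).trans (by push_cast; linarith)
    intro x y _ _ _ _ _ _ _
    interval_cases x <;> interval_cases y <;> first | omega | norm_num

theorem M1_le_of_odd {n : ℕ} (hn : 2 ≤ n) (ho : Odd n) {ζ : GV n → ℕ}
    (hζ : IsProperColoring (flowerGraph n) 4 ζ) : M1 ζ ≤ 25 * n - 4 := by
  obtain ⟨hb, hc, hs⟩ := (isProperColoring_flowerGraph_iff hn _ _).1 hζ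
  have hn' : (2 : ℚ) ≤ n := by exact_mod_cast hn
  have h0 := hb none
  have key (W m : ℚ) (a b : ℕ) (hW : ∀ x y : ℕ, 1 ≤ x → x ≤ 4 → 1 ≤ y → y ≤ 4 → x ≠ y →
      ζ none ≠ x → ζ none ≠ y → (x : ℚ) ^ 2 + (y : ℚ) ^ 2 ≤ W ∧
        (x ≠ a → x ≠ b → (x : ℚ) ^ 2 + (y : ℚ) ^ 2 ≤ m)) :
      M1 ζ ≤ (ζ none : ℚ) ^ 2 + (W * n - (W - m)) := by
    have hW' (i : Fin n) :=
      hW _ _ (hb _).1 (hb _).2 (hb _).1 (hb _).2 (hs i).2.2 (hs i).1 (hs i).2.1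
    obtain ⟨i, hi⟩ := ho.exists_ne_ne_of_nextIdx _ hc a b
    rw [M1_eq]
    gcongr
    exact sum_le_of_exists_le (fun i => (hW' i).1) ⟨i, (hW' i).2 hi.1 hi.2⟩
  obtain h | h | h | h : ζ none = 1 ∨ ζ none = 2 ∨ ζ none = 3 ∨ ζ none = 4 := by omega
  all_goals rw [h] at key
  · refine (key 25 20 3 4 ?_).trans (by push_cast; linarith)
    intro x y _ _ _ _ _ _ _
    interval_cases x <;> interval_cases y <;> first | omega | norm_num
  · refine (key 25 17 3 4 ?_).trans (by push_cast; linarith)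
    intro x y _ _ _ _ _ _ _
    interval_cases x <;> interval_cases y <;> first | omega | norm_num
  · refine (key 20 17 2 4 ?_).trans (by push_cast; linarith)
    intro x y _ _ _ _ _ _ _
    interval_cases x <;> interval_cases y <;> first | omega | norm_num
  · refine (key 13 10 2 3 ?_).trans (by push_cast; linarith)
    intro x y _ _ _ _ _ _ _
    interval_cases x <;> interval_cases y <;> first | omega | norm_num

theorem flower_M1_max (n : ℕ) (hn : 3 ≤ n) :
    (Even n → IsGreatest {x : ℚ | ∃ ζ : GV n → ℕ,
        IsProperColoring (flowerGraph n) (chi (flowerGraph n)) ζ ∧ x = M1 ζ}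
      (13 * (n : ℚ) + 1)) ∧
    (Odd n → IsGreatest {x : ℚ | ∃ ζ : GV n → ℕ,
        IsProperColoring (flowerGraph n) (chi (flowerGraph n)) ζ ∧ x = M1 ζ}
      (25 * (n : ℚ) - 4)) := by
  have hn2 : 2 ≤ n := by omega
  refine ⟨fun he => ?_, fun ho => ?_⟩
  · rw [chi_flowerGraph_of_even hn2 he]
    refine ⟨⟨_, isProperColoring_evenFlowerColoring hn2 he, (M1_evenFlowerColoring n).symm⟩, ?_⟩
    rintro _ ⟨ζ, hζ, rfl⟩
    exact M1_le_of_even hn2 hζ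
  · rw [chi_flowerGraph_of_odd hn2 ho]
    refine ⟨⟨_, isProperColoring_oddFlowerColoring hn2,
      (M1_oddFlowerColoring (by omega)).symm⟩, ?_⟩
    rintro _ ⟨ζ, hζ, rfl⟩
    exact M1_le_of_odd hn2 ho hζ
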